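/- Let 0 < β < 1 and ω > 0. Then the function V(t) = ω t^β E_{2β,β+1}(−ω^2 t^{2β}) = ∑_{n=0}^∞ (−1)^n ω^{2n+1} t^{(2n+1)β} / Γ((2n+1)β + 1) satisfies the fractional oscillator equation (D_c^β)^2 V(t) + ω^2 V(t) = 0 for all t > 0 with V(0) = 0; moreover V(t) equals the Wright-type transform of s ↦ sin(ωs), i.e. V(t) = ∫_0^∞ g_β(x;t) sin(ωx) dx. -/

import Mathlib

open MeasureTheory Real Set Filter

/-- The Wright-type density `g_β(x;t) = t^{-β} ∑_{k} (−x/t^β)^k / (k! Γ(1 − β(k+1)))`. -/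
noncomputable def wrightG (β x t : ℝ) : ℝ :=
  t ^ (-β) * ∑' k : ℕ, (-x / t ^ β) ^ k / ((Nat.factorial k : ℝ) * Real.Gamma (1 - β * (k + 1)))

/-- The two-parameter Mittag-Leffler function `E_{β,α}(z) = ∑_k z^k / Γ(βk + α)`. -/
noncomputable def mittagLeffler (β α z : ℝ) : ℝ :=
  ∑' k : ℕ, z ^ k / Real.Gamma (β * k + α)

/-- The Caputo fractional derivative of order `β ∈ (0,1)`:
`D_c^β h(t) = (1/Γ(1−β)) ∫_0^t (t−τ)^{−β} h′(τ) dτ`. -/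
noncomputable def caputo (β : ℝ) (h : ℝ → ℝ) (t : ℝ) : ℝ :=
  (1 / Real.Gamma (1 - β)) * ∫ τ in (0:ℝ)..t, (t - τ) ^ (-β) * deriv h τ

/-- A function is of exponential order on `[0,∞)` if `|h(x)| ≤ C e^{a x}` there. -/
def ExpOrder (h : ℝ → ℝ) : Prop :=
  ∃ C a : ℝ, 0 < C ∧ 0 < a ∧ ∀ x : ℝ, 0 ≤ x → |h x| ≤ C * Real.exp (a * x)

/-- Laplace transform of a power function at a complex argument. -/
theorem integral_rpow_mul_cexp_neg_mul_Ioi {z : ℝ} (hz : 0 < z) {q : ℂ} (hq : 0 < q.re) :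
    ∫ r in Ioi (0:ℝ), ((r ^ (z - 1) : ℝ) : ℂ) * Complex.exp (-(q * r)) =
      (1 / q) ^ (z : ℂ) * (Real.Gamma z : ℂ) := by
  have hInt : ∀ p : ℝ, 0 < p → ∀ k : ℝ, 0 < k → IntegrableOn (fun r : ℝ => r ^ (p - 1) * rexp (-k * r)) (Ioi 0) := by
    intro p hp k hk
    exact integrableOn_rpow_mul_exp_neg_mul_rpow (p := 1) (s := p - 1) (by linarith) one_pos hk
      |>.congr_fun (fun r _ => by simp) measurableSet_Ioi
  have hmeas : ∀ p : ℝ, ∀ q : ℂ, AEStronglyMeasurable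
      (fun r : ℝ => ((r ^ (p - 1) : ℝ) : ℂ) * Complex.exp (-(q * r))) (volume.restrict (Ioi 0)) := by
    intro p q
    exact Measurable.aestronglyMeasurable (by fun_prop)
  have hnorm : ∀ p : ℝ, ∀ q : ℂ, ∀ r : ℝ, 0 < r →
      ‖((r ^ (p - 1) : ℝ) : ℂ) * Complex.exp (-(q * r))‖ = r ^ (p - 1) * rexp (-q.re * r) := by
    intro p q r hr
    rw [norm_mul, Complex.norm_exp, Complex.norm_real, Real.norm_of_nonneg (by positivity)]
    simp
  have hdiff : DifferentiableOn ℂ (fun q : ℂ => ∫ r in Ioi (0:ℝ),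
      ((r ^ (z - 1) : ℝ) : ℂ) * Complex.exp (-(q * r))) {q | 0 < q.re} := by
    intro q hq
    have hq : 0 < q.re := hq
    refine DifferentiableAt.differentiableWithinAt ?_
    refine (hasDerivAt_integral_of_dominated_loc_of_deriv_le (s := {w | q.re / 2 < w.re})
      (F' := fun w r => -(((r ^ ((z + 1) - 1) : ℝ) : ℂ) * Complex.exp (-(w * r))))
      (bound := fun r => r ^ ((z + 1) - 1) * rexp (-(q.re / 2) * r)) ?_ ?_ ?_ ?_ ?_ ?_ ?_).2.differentiableAt
    · exact (isOpen_lt continuous_const Complex.continuous_re).mem_nhds (by simp; linarith)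
    · exact Eventually.of_forall fun w => hmeas z w
    · refine (hInt z hz q.re hq).mono' (hmeas z q) ?_
      filter_upwards [ae_restrict_mem measurableSet_Ioi] with r hr
      exact (hnorm z q r hr).le
    · exact (hmeas _ _).neg
    · filter_upwards [ae_restrict_mem measurableSet_Ioi] with r hr w hw
      rw [norm_neg, hnorm _ _ _ hr]
      have hr : 0 < r := hr
      have hw : q.re / 2 < w.re := hw
      gcongr
    · exact hInt _ (by linarith) _ (by linarith)
    · filter_upwards [ae_restrict_mem measurableSet_Ioi] with r hr w hw
      have hr : 0 < r := hr
      have h1 : HasDerivAt (fun w : ℂ => -(w * r)) (-(1 * (r:ℂ))) w :=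
        ((hasDerivAt_id w).mul_const (r:ℂ)).neg
      have := (h1.cexp).const_mul ((r ^ (z - 1) : ℝ) : ℂ)
      refine this.congr_deriv ?_
      have : r ^ (z + 1 - 1) = r ^ (z - 1) * r := by
        rw [← rpow_add_one hr.ne']; ring_nf
      rw [this]; push_cast; ring
  have hopen : IsOpen {q : ℂ | 0 < q.re} := isOpen_lt continuous_const Complex.continuous_re
  have hdiff2 : DifferentiableOn ℂ (fun q : ℂ => (1 / q) ^ (z : ℂ) * (Real.Gamma z : ℂ)) {q | 0 < q.re} := by
    intro q hq
    have hq : 0 < q.re := hq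
    have hq0 : q ≠ 0 := fun h => by simp [h] at hq
    refine DifferentiableAt.differentiableWithinAt ?_
    refine DifferentiableAt.mul_const (DifferentiableAt.cpow_const (by fun_prop (disch := assumption)) ?_) _
    rw [one_div]
    left
    rw [Complex.inv_re]
    have := Complex.normSq_pos.2 hq0
    positivity
  have key := (hdiff.analyticOnNhd hopen).eqOn_of_preconnected_of_frequently_eq
    (hdiff2.analyticOnNhd hopen) (z₀ := 1)
    (convex_halfSpace_re_gt 0).isPreconnected (by simp) ?_
  · exact key hq
  have hreal : ∀ k : ℝ, 0 < k → ∫ r in Ioi (0:ℝ), ((r ^ (z - 1) : ℝ) : ℂ) * Complex.exp (-((k:ℂ) * r)) =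
      (1 / (k:ℂ)) ^ (z : ℂ) * (Real.Gamma z : ℂ) := by
    intro k hk
    rw [← Complex.Gamma_ofReal, ← Complex.integral_cpow_mul_exp_neg_mul_Ioi (by simpa using hz) hk]
    refine setIntegral_congr_fun measurableSet_Ioi fun r hr => ?_
    have hr : 0 < r := hr
    simp only [Complex.ofReal_cpow hr.le]
    push_cast; rfl
  have htend : Tendsto (fun n : ℕ => ((1 + 1 / ((n:ℝ) + 1) : ℝ) : ℂ)) atTop (nhdsWithin 1 {1}ᶜ) := by
    refine tendsto_nhdsWithin_iff.2 ⟨?_, Eventually.of_forall fun n => ?_⟩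
    · have := (tendsto_one_div_add_atTop_nhds_zero_nat (𝕜 := ℝ)).const_add 1
      have := (Complex.continuous_ofReal.tendsto _).comp this
      simpa [Function.comp_def] using this
    · simp only [mem_compl_iff, mem_singleton_iff]
      intro h
      have h := congrArg Complex.re h
      simp only [Complex.ofReal_re, Complex.one_re] at h
      have : 0 < 1 / ((n:ℝ) + 1) := by positivity
      linarith
  exact htend.frequently (Eventually.frequently (Eventually.of_forall fun n => hreal _ (by positivity)))

/-- The oblique half-line `R + r e^{iφ}`, `r ≥ 0`. -/
noncomputable def obliqueRay (φ R r : ℝ) : ℂ := R + r * Complex.exp (φ * Complex.I)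

theorem obliqueRay_re (φ R r : ℝ) : (obliqueRay φ R r).re = R + r * cos φ := by
  simp [obliqueRay, Complex.exp_ofReal_mul_I_re]

theorem obliqueRay_im (φ R r : ℝ) : (obliqueRay φ R r).im = r * sin φ := by
  simp [obliqueRay, Complex.exp_ofReal_mul_I_im]

theorem norm_obliqueRay_le (φ : ℝ) {R r : ℝ} (hr : 0 ≤ r) : ‖obliqueRay φ R r‖ ≤ |R| + r := by
  refine (norm_add_le _ _).trans ?_
  simp [Complex.norm_exp_ofReal_mul_I, abs_of_nonneg hr]

theorem mul_sin_le_norm_obliqueRay {φ R r : ℝ} :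
    R * sin φ ≤ ‖obliqueRay φ R r‖ := by
  rw [Complex.norm_def]
  refine Real.le_sqrt_of_sq_le ?_
  rw [Complex.normSq_apply, obliqueRay_re, obliqueRay_im]
  have : (R + r * cos φ) * (R + r * cos φ) + r * sin φ * (r * sin φ) =
      (R * cos φ + r) ^ 2 + (R * sin φ) ^ 2 := by
    linear_combination (r ^ 2 - R ^ 2) * sin_sq_add_cos_sq φ
  nlinarith [sq_nonneg (R * cos φ + r)]

theorem obliqueRay_mem_slitPlane {φ R r : ℝ} (h0 : 0 < sin φ) (hr : 0 ≤ r) (h : 0 < R ∨ 0 < r) :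
    obliqueRay φ R r ∈ Complex.slitPlane := by
  rw [Complex.mem_slitPlane_iff, obliqueRay_re, obliqueRay_im]
  rcases hr.eq_or_lt with rfl | hr
  · left; simpa using h
  · right; positivity

theorem arg_obliqueRay_nonneg {φ R r : ℝ} (h0 : 0 < sin φ) (hr : 0 ≤ r) :
    0 ≤ (obliqueRay φ R r).arg := by
  rw [Complex.arg_nonneg_iff, obliqueRay_im]; positivity

theorem arg_obliqueRay_le {φ R r : ℝ} (hφ0 : 0 < φ) (hφ : φ < π) (hR : 0 < R) (hr : 0 ≤ r) :
    (obliqueRay φ R r).arg ≤ φ := by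
  have hs : 0 < sin φ := sin_pos_of_pos_of_lt_pi hφ0 hφ
  by_contra! h
  set s := obliqueRay φ R r with hsdef
  have hs0 : s ≠ 0 := Complex.slitPlane_ne_zero (obliqueRay_mem_slitPlane hs hr (Or.inl hR))
  have h1 : 0 < sin (s.arg - φ) := sin_pos_of_pos_of_lt_pi (by linarith) (by linarith [Complex.arg_le_pi s])
  rw [sin_sub, Complex.sin_arg, Complex.cos_arg hs0, obliqueRay_re, obliqueRay_im] at h1
  have hn : 0 < ‖s‖ := norm_pos_iff.2 hs0
  have h2 : r * sin φ / ‖s‖ * cos φ - (R + r * cos φ) / ‖s‖ * sin φ = - (R * sin φ / ‖s‖) := by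
    field_simp; ring
  rw [h2] at h1
  have : 0 < R * sin φ / ‖s‖ := by positivity
  linarith

/-- Along an oblique ray of angle `φ` with `βφ < π/2`, the real part of `s ^ β` controls its
modulus. -/
theorem cos_mul_rpow_le_re_cpow {φ R r β : ℝ} (hφ0 : 0 < φ) (hφ : φ < π) (hβ : 0 < β)
    (hβφ : β * φ < π / 2) (hR : 0 < R) (hr : 0 ≤ r) :
    cos (β * φ) * ‖obliqueRay φ R r‖ ^ β ≤ ((obliqueRay φ R r) ^ (β : ℂ)).re := by
  rw [Complex.cpow_ofReal_re, mul_comm]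
  have h1 := arg_obliqueRay_le hφ0 hφ hR hr
  have h2 := arg_obliqueRay_nonneg (R := R) (sin_pos_of_pos_of_lt_pi hφ0 hφ) hr
  gcongr
  refine cos_le_cos_of_nonneg_of_le_pi (by positivity) (by linarith [pi_pos]) ?_
  rw [mul_comm β]; gcongr

theorem continuous_obliqueRay (φ R : ℝ) : Continuous (obliqueRay φ R) := by
  unfold obliqueRay; fun_prop

theorem hasDerivAt_obliqueRay (φ R r : ℝ) :
    HasDerivAt (obliqueRay φ R) (Complex.exp (φ * Complex.I)) r := by
  unfold obliqueRay
  have := ((Complex.ofRealCLM.hasDerivAt (x := r)).mul_const (Complex.exp (φ * Complex.I))).const_add (R:ℂ)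
  simpa using this

theorem hasDerivAt_obliqueRay_left (φ R r : ℝ) :
    HasDerivAt (fun R => obliqueRay φ R r) 1 R := by
  unfold obliqueRay
  have := (Complex.ofRealCLM.hasDerivAt (x := R)).add_const (r * Complex.exp (φ * Complex.I))
  simpa using this

/-- Growth of a power times a stretched exponential is dominated by any exponential. -/
theorem exists_rpow_mul_exp_rpow_le {β : ℝ} (hβ1 : β < 1) (p : ℝ) {A m ε : ℝ}
    (hm : 0 < m) (hε : 0 < ε) :
    ∃ C, 0 < C ∧ ∀ y, m ≤ y → y ^ p * rexp (A * y ^ β) ≤ C * rexp (ε * y) := by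
  have hcont : ContinuousOn (fun y : ℝ => y ^ p * rexp (A * y ^ β) * rexp (-(ε * y))) (Ici m) := by
    intro y hy
    have hy : y ≠ 0 := (hm.trans_le hy).ne'
    apply ContinuousAt.continuousWithinAt
    have := continuousAt_rpow_const y p (Or.inl hy)
    have := continuousAt_rpow_const y β (Or.inl hy)
    fun_prop
  have hlim : ∃ Y, m ≤ Y ∧ ∀ y, Y ≤ y → y ^ p * rexp (A * y ^ β) * rexp (-(ε * y)) ≤ 1 := by
    have h1 := (isLittleO_rpow_exp_pos_mul_atTop p (half_pos hε)).bound one_pos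
    have h2 : ∀ᶠ y : ℝ in atTop, A * y ^ (-(1 - β)) < ε / 2 := by
      have := (tendsto_rpow_neg_atTop (sub_pos.2 hβ1)).const_mul A
      rw [mul_zero] at this
      exact this.eventually_lt_const (half_pos hε)
    obtain ⟨Y, hY⟩ := eventually_atTop.1 (h1.and (h2.and (eventually_ge_atTop m)))
    refine ⟨max Y m, le_max_right _ _, fun y hy => ?_⟩
    obtain ⟨a1, a2, a3⟩ := hY y ((le_max_left _ _).trans hy)
    have hy0 : 0 < y := hm.trans_le a3
    rw [Real.norm_of_nonneg (by positivity), Real.norm_of_nonneg (by positivity), one_mul] at a1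
    have a4 : A * y ^ β ≤ ε / 2 * y := by
      have : y ^ β = y ^ (-(1 - β)) * y := by
        rw [← rpow_add_one hy0.ne']; ring_nf
      rw [this, ← mul_assoc]
      gcongr
    calc y ^ p * rexp (A * y ^ β) * rexp (-(ε * y))
        ≤ rexp (ε / 2 * y) * rexp (ε / 2 * y) * rexp (-(ε * y)) := by gcongr
      _ = 1 := by rw [← exp_add, ← exp_add]; ring_nf; simp
  obtain ⟨Y, hmY, hY⟩ := hlim
  obtain ⟨B, hB⟩ := isCompact_Icc.exists_bound_of_continuousOn 
    (hcont.mono (show Icc m Y ⊆ Ici m from fun y hy => hy.1))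
  refine ⟨max 1 B, by positivity, fun y hy => ?_⟩
  have : y ^ p * rexp (A * y ^ β) * rexp (-(ε * y)) ≤ max 1 B := by
    rcases le_total Y y with h | h
    · exact (hY y h).trans (le_max_left _ _)
    · exact ((le_abs_self _).trans (hB y ⟨hy, h⟩)).trans (le_max_right _ _)
  calc y ^ p * rexp (A * y ^ β) = y ^ p * rexp (A * y ^ β) * rexp (-(ε * y)) * rexp (ε * y) := by
        rw [mul_assoc, ← exp_add]; simp
    _ ≤ _ := by gcongr

/-- Exponential decay of the contour integrands along the oblique ray, as a bound in `K + r`. -/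
theorem exists_contour_bound {β φ : ℝ} (hβ1 : β < 1) (hc : cos φ < 0) (p : ℝ) {A K : ℝ}
    (hK : 0 < K) :
    ∃ C, 0 < C ∧ ∀ r, 0 ≤ r → rexp (r * cos φ) * ((K + r) ^ p * rexp (A * (K + r) ^ β)) ≤
      C * rexp (cos φ / 2 * r) := by
  obtain ⟨C, hC, h⟩ := exists_rpow_mul_exp_rpow_le hβ1 p hK (ε := -cos φ / 2) (by linarith)
  refine ⟨C * rexp (-cos φ / 2 * K), by positivity, fun r hr => ?_⟩
  calc _ ≤ rexp (r * cos φ) * (C * rexp (-cos φ / 2 * (K + r))) := by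
        exact mul_le_mul_of_nonneg_left (h _ (by linarith)) (exp_pos _).le
    _ = C * rexp (-cos φ / 2 * K) * rexp (cos φ / 2 * r) := by
        rw [mul_left_comm, mul_assoc, ← exp_add, ← exp_add]; ring_nf

theorem exists_contour_norm_bound {β φ : ℝ} (hβ1 : β < 1) (hs : 0 < sin φ) (hc : cos φ < 0) (p : ℝ)
    {A R : ℝ} (hR : 0 < R) :
    ∃ C, 0 < C ∧ ∀ r, 0 ≤ r →
      rexp (obliqueRay φ R r).re * (‖obliqueRay φ R r‖ ^ p * rexp (A * ‖obliqueRay φ R r‖ ^ β)) ≤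
        C * rexp (cos φ / 2 * r) := by
  obtain ⟨C, hC, h⟩ := exists_rpow_mul_exp_rpow_le hβ1 p (m := R * sin φ) (by positivity)
    (ε := -cos φ / 2) (by linarith)
  refine ⟨C * rexp (R - cos φ / 2 * R), by positivity, fun r hr => ?_⟩
  have hle := norm_obliqueRay_le φ (R := R) hr
  rw [abs_of_pos hR] at hle
  calc _ ≤ rexp (obliqueRay φ R r).re * (C * rexp (-cos φ / 2 * ‖obliqueRay φ R r‖)) := by
        exact mul_le_mul_of_nonneg_left (h _ mul_sin_le_norm_obliqueRay) (exp_pos _).le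
    _ ≤ rexp (obliqueRay φ R r).re * (C * rexp (-cos φ / 2 * (R + r))) := by
        gcongr; linarith
    _ = _ := by
        rw [obliqueRay_re, mul_left_comm, mul_assoc, ← exp_add, ← exp_add]; ring_nf

theorem integrableOn_contour_majorant {β φ : ℝ} (hβ1 : β < 1) (hs : 0 < sin φ)
    (hc : cos φ < 0) (p : ℝ) {A R : ℝ} (hR : 0 < R) :
    IntegrableOn (fun r => rexp (obliqueRay φ R r).re *
      (‖obliqueRay φ R r‖ ^ p * rexp (A * ‖obliqueRay φ R r‖ ^ β))) (Ioi 0) := by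
  obtain ⟨C, hC, h⟩ := exists_contour_norm_bound hβ1 hs hc p hR
  refine ((integrableOn_exp_mul_Ioi (a := cos φ / 2) (by linarith) 0).const_mul C).mono' ?_ ?_
  · have := (continuous_obliqueRay φ R).measurable
    exact Measurable.aestronglyMeasurable (by fun_prop)
  · filter_upwards [ae_restrict_mem measurableSet_Ioi] with r hr
    rw [Real.norm_of_nonneg (by positivity)]
    exact h r (le_of_lt hr)

theorem integrableOn_contour_rpow {φ : ℝ} (hs : 0 < sin φ)
    (hc : cos φ < 0) (p : ℝ) {R : ℝ} (hR : 0 < R) :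
    IntegrableOn (fun r => rexp (obliqueRay φ R r).re * ‖obliqueRay φ R r‖ ^ p) (Ioi 0) := by
  simpa using integrableOn_contour_majorant zero_lt_one hs hc p (A := 0) hR

/-- Upper half of Hankel's contour integral for `1 / Γ(1 - z)`, taken along an oblique ray. -/
noncomputable def hankelIntegral (φ R z : ℝ) : ℂ :=
  ∫ r in Ioi (0:ℝ), Complex.exp (obliqueRay φ R r) * obliqueRay φ R r ^ ((z - 1 : ℝ) : ℂ) *
    Complex.exp (φ * Complex.I)

theorem norm_contour_integrand (φ R r p : ℝ) :
    ‖Complex.exp (obliqueRay φ R r) * obliqueRay φ R r ^ (p : ℂ) * Complex.exp (φ * Complex.I)‖ =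
      rexp (obliqueRay φ R r).re * ‖obliqueRay φ R r‖ ^ p := by
  rw [norm_mul, norm_mul, Complex.norm_exp, Complex.norm_cpow_real, Complex.norm_exp_ofReal_mul_I,
    mul_one]

theorem measurable_contour_integrand (φ R p : ℝ) :
    Measurable fun r => Complex.exp (obliqueRay φ R r) * obliqueRay φ R r ^ (p : ℂ) *
      Complex.exp (φ * Complex.I) := by
  have := (continuous_obliqueRay φ R).measurable
  fun_prop

theorem integrableOn_contour_integrand {φ R : ℝ} (hs : 0 < sin φ) (hc : cos φ < 0) (hR : 0 < R)
    (p : ℝ) :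
    IntegrableOn (fun r => Complex.exp (obliqueRay φ R r) * obliqueRay φ R r ^ (p : ℂ) *
      Complex.exp (φ * Complex.I)) (Ioi 0) :=
  (integrableOn_contour_rpow hs hc p hR).mono'
    (measurable_contour_integrand φ R p).aestronglyMeasurable
    (Eventually.of_forall fun r => (norm_contour_integrand φ R r p).le)

theorem hasDerivAt_cexp_mul_cpow {s : ℂ} (hs : s ∈ Complex.slitPlane) (p : ℝ) :
    HasDerivAt (fun s => Complex.exp s * s ^ (p : ℂ))
      (Complex.exp s * s ^ (p : ℂ) + p * (Complex.exp s * s ^ ((p - 1 : ℝ) : ℂ))) s := by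
  refine ((Complex.hasDerivAt_exp s).mul ((hasDerivAt_id s).cpow_const (c := (p : ℂ)) hs)).congr_deriv ?_
  simp
  ring

theorem integral_contour_deriv {φ R : ℝ} (hs : 0 < sin φ) (hc : cos φ < 0) (hR : 0 < R) (p : ℝ) :
    ∫ r in Ioi (0:ℝ), (Complex.exp (obliqueRay φ R r) * obliqueRay φ R r ^ (p : ℂ) *
      Complex.exp (φ * Complex.I) + p * (Complex.exp (obliqueRay φ R r) *
        obliqueRay φ R r ^ ((p - 1 : ℝ) : ℂ) * Complex.exp (φ * Complex.I))) =
      -((rexp R * R ^ p : ℝ) : ℂ) := by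
  have hderiv : ∀ r, 0 ≤ r → HasDerivAt (fun r => Complex.exp (obliqueRay φ R r) *
      obliqueRay φ R r ^ (p : ℂ)) (Complex.exp (obliqueRay φ R r) * obliqueRay φ R r ^ (p : ℂ) *
      Complex.exp (φ * Complex.I) + p * (Complex.exp (obliqueRay φ R r) *
        obliqueRay φ R r ^ ((p - 1 : ℝ) : ℂ) * Complex.exp (φ * Complex.I))) r := by
    intro r hr
    refine ((hasDerivAt_cexp_mul_cpow (obliqueRay_mem_slitPlane hs hr (Or.inl hR)) p).comp r
      (hasDerivAt_obliqueRay φ R r)).congr_deriv ?_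
    ring
  obtain ⟨C, -, hC⟩ := exists_contour_norm_bound zero_lt_one hs hc p (A := 0) hR
  rw [integral_Ioi_of_hasDerivAt_of_tendsto (m := 0) (hderiv 0 le_rfl).continuousAt.continuousWithinAt
    (fun r hr => hderiv r (le_of_lt hr))
    ((integrableOn_contour_integrand hs hc hR p).add
      ((integrableOn_contour_integrand hs hc hR (p - 1)).const_mul _))]
  · simp [obliqueRay, Complex.ofReal_cpow hR.le]
  · have hlim : Tendsto (fun r => C * rexp (cos φ / 2 * r)) atTop (nhds 0) := by
      rw [← mul_zero C]
      refine Tendsto.const_mul C (tendsto_exp_atBot.comp ?_)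
      exact tendsto_id.const_mul_atTop_of_neg (by linarith)
    refine squeeze_zero_norm' ?_ hlim
    filter_upwards [eventually_ge_atTop 0] with r hr
    rw [norm_mul, Complex.norm_exp, Complex.norm_cpow_real]
    simpa using hC r hr

theorem hankelIntegral_add_one {φ R : ℝ} (hs : 0 < sin φ) (hc : cos φ < 0) (hR : 0 < R) (z : ℝ) :
    hankelIntegral φ R (z + 1) + z * hankelIntegral φ R z = -((rexp R * R ^ z : ℝ) : ℂ) := by
  rw [← integral_contour_deriv hs hc hR z, integral_add (integrableOn_contour_integrand hs hc hR z)
    ((integrableOn_contour_integrand hs hc hR (z - 1)).const_mul _), integral_const_mul]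
  simp [hankelIntegral]

theorem hankelIntegral_add_one_im {φ R : ℝ} (hs : 0 < sin φ) (hc : cos φ < 0) (hR : 0 < R) (z : ℝ) :
    (hankelIntegral φ R (z + 1)).im = -z * (hankelIntegral φ R z).im := by
  have h := congrArg Complex.im (hankelIntegral_add_one hs hc hR z)
  rw [Complex.add_im, Complex.im_ofReal_mul, Complex.neg_im, Complex.ofReal_im] at h
  linarith

theorem hasDerivAt_hankelIntegral {φ R z : ℝ} (hs : 0 < sin φ) (hc : cos φ < 0) (hR : 0 ≤ R)
    (hz : 2 < z) :
    HasDerivAt (fun R => hankelIntegral φ R z) (∫ r in Ioi (0:ℝ),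
      (Complex.exp (obliqueRay φ R r) * obliqueRay φ R r ^ ((z - 1 : ℝ) : ℂ) *
      Complex.exp (φ * Complex.I) + (z - 1 : ℝ) * (Complex.exp (obliqueRay φ R r) *
        obliqueRay φ R r ^ ((z - 1 - 1 : ℝ) : ℂ) * Complex.exp (φ * Complex.I)))) R := by
  have hK : 0 < R + 1 := by linarith
  have hbi : ∀ p : ℝ, IntegrableOn (fun r => rexp (r * cos φ) * (R + 1 + r) ^ p) (Ioi 0) := by
    intro p
    obtain ⟨C, -, hC⟩ := exists_contour_bound zero_lt_one hc p (A := 0) hK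
    refine ((integrableOn_exp_mul_Ioi (a := cos φ / 2) (by linarith) 0).const_mul C).mono'
      (Measurable.aestronglyMeasurable (by fun_prop)) ?_
    filter_upwards [ae_restrict_mem measurableSet_Ioi] with r hr
    have hr : 0 < r := hr
    rw [Real.norm_of_nonneg (by positivity)]
    simpa using hC r hr.le
  have hb : ∀ p : ℝ, 0 ≤ p → ∀ r, 0 < r → ∀ R' ∈ Metric.ball R 1,
      rexp (obliqueRay φ R' r).re * ‖obliqueRay φ R' r‖ ^ p ≤
        rexp (R + 1) * (rexp (r * cos φ) * (R + 1 + r) ^ p) := by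
    intro p hp r hr R' hR'
    rw [Metric.mem_ball, Real.dist_eq, abs_lt] at hR'
    have h1 : ‖obliqueRay φ R' r‖ ≤ R + 1 + r := by
      have := abs_le.2 (show -(R + 1) ≤ R' ∧ R' ≤ R + 1 by constructor <;> linarith)
      linarith [norm_obliqueRay_le φ (R := R') hr.le]
    rw [← mul_assoc, ← exp_add, obliqueRay_re]
    gcongr
    linarith
  refine (hasDerivAt_integral_of_dominated_loc_of_deriv_le (s := Metric.ball R 1)
      (bound := fun r => rexp (R + 1) * (rexp (r * cos φ) * (R + 1 + r) ^ (z - 1)) +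
        (z - 1) * (rexp (R + 1) * (rexp (r * cos φ) * (R + 1 + r) ^ (z - 1 - 1))))
      (F' := fun R r => Complex.exp (obliqueRay φ R r) * obliqueRay φ R r ^ ((z - 1 : ℝ) : ℂ) *
      Complex.exp (φ * Complex.I) + (z - 1 : ℝ) * (Complex.exp (obliqueRay φ R r) *
        obliqueRay φ R r ^ ((z - 1 - 1 : ℝ) : ℂ) * Complex.exp (φ * Complex.I)))
      (Metric.ball_mem_nhds _ one_pos) ?_ ?_ ?_ ?_ ?_ ?_).2
  · exact Eventually.of_forall fun R => (measurable_contour_integrand φ R _).aestronglyMeasurable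
  · refine ((hbi (z - 1)).const_mul (rexp (R + 1))).mono'
      (measurable_contour_integrand φ R _).aestronglyMeasurable ?_
    filter_upwards [ae_restrict_mem measurableSet_Ioi] with r hr
    rw [norm_contour_integrand]
    exact hb _ (by linarith) r hr R (Metric.mem_ball_self one_pos)
  · exact ((measurable_contour_integrand φ R _).add
      ((measurable_contour_integrand φ R _).const_mul _)).aestronglyMeasurable
  · filter_upwards [ae_restrict_mem measurableSet_Ioi] with r hr R' hR'
    refine (norm_add_le _ _).trans ?_
    rw [norm_mul ((z - 1 : ℝ) : ℂ), norm_contour_integrand, norm_contour_integrand,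
      Complex.norm_real, Real.norm_of_nonneg (by linarith)]
    have := hb (z - 1) (by linarith) r hr R' hR'
    have := mul_le_mul_of_nonneg_left (hb (z - 1 - 1) (by linarith) r hr R' hR')
      (show 0 ≤ z - 1 by linarith)
    linarith
  · exact ((hbi _).const_mul _).add (((hbi _).const_mul _).const_mul _)
  · filter_upwards [ae_restrict_mem measurableSet_Ioi] with r hr R' hR'
    have hr : 0 < r := hr
    refine (((hasDerivAt_cexp_mul_cpow (obliqueRay_mem_slitPlane hs hr.le (Or.inr hr))
      (z - 1)).comp R' (hasDerivAt_obliqueRay_left φ R' r)).mul_const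
      (Complex.exp (φ * Complex.I))).congr_deriv ?_
    ring

theorem hankelIntegral_zero_im {φ z : ℝ} (hφ0 : 0 < φ) (hφ : φ < π) (hc : cos φ < 0) (hz : 0 < z) :
    (hankelIntegral φ 0 z).im = sin (π * z) * Real.Gamma z := by
  have hq : 0 < (-Complex.exp (φ * Complex.I)).re := by
    simp [Complex.exp_ofReal_mul_I_re, hc]
  have hlog : Complex.log (Complex.exp (φ * Complex.I)) = φ * Complex.I :=
    Complex.log_exp (by simp; linarith) (by simp; linarith)
  have hinv : 1 / -Complex.exp (φ * Complex.I) = Complex.exp (((π - φ : ℝ) : ℂ) * Complex.I) := by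
    rw [one_div, inv_neg, ← Complex.exp_neg]
    push_cast
    rw [sub_mul, sub_eq_add_neg, Complex.exp_add, Complex.exp_pi_mul_I]
    ring
  have hlog2 : Complex.log (Complex.exp (((π - φ : ℝ) : ℂ) * Complex.I)) =
      ((π - φ : ℝ) : ℂ) * Complex.I :=
    Complex.log_exp (by simp; linarith) (by simp; linarith)
  have hint : hankelIntegral φ 0 z =
      Complex.exp (φ * Complex.I * (z - 1 : ℝ)) * Complex.exp (φ * Complex.I) *
      ∫ r in Ioi (0:ℝ), ((r ^ (z - 1) : ℝ) : ℂ) *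
        Complex.exp (-(-Complex.exp (φ * Complex.I) * r)) := by
    rw [hankelIntegral, ← integral_const_mul]
    refine setIntegral_congr_fun measurableSet_Ioi fun r hr => ?_
    have hr : 0 < r := hr
    have hr0 : (r : ℂ) ≠ 0 := by exact_mod_cast hr.ne'
    have hcp : ((r : ℂ) * Complex.exp (φ * Complex.I)) ^ ((z - 1 : ℝ) : ℂ) =
        ((r ^ (z - 1) : ℝ) : ℂ) * Complex.exp (φ * Complex.I * (z - 1 : ℝ)) := by
      rw [Complex.cpow_def_of_ne_zero (mul_ne_zero hr0 (Complex.exp_ne_zero _)),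
        Complex.log_ofReal_mul hr (Complex.exp_ne_zero _), hlog, add_mul, Complex.exp_add,
        rpow_def_of_pos hr]
      push_cast
      rfl
    simp only [obliqueRay, Complex.ofReal_zero, zero_add, hcp]
    rw [show -(-Complex.exp (φ * Complex.I) * (r : ℂ)) = r * Complex.exp (φ * Complex.I) by ring]
    ring
  rw [hint, integral_rpow_mul_cexp_neg_mul_Ioi hz hq, hinv,
    Complex.cpow_def_of_ne_zero (Complex.exp_ne_zero _), hlog2, ← mul_assoc, ← Complex.exp_add,
    ← Complex.exp_add, mul_comm, Complex.im_ofReal_mul, mul_comm]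
  congr 1
  rw [← Complex.exp_ofReal_mul_I_im]
  congr 2
  push_cast
  ring

theorem hankelIntegral_im_eq_zero_im {φ R z : ℝ} (hs : 0 < sin φ) (hc : cos φ < 0) (hR : 0 < R)
    (hz : 2 < z) : (hankelIntegral φ R z).im = (hankelIntegral φ 0 z).im := by
  have hd : ∀ R, 0 ≤ R → HasDerivAt (fun R => (hankelIntegral φ R z).im) _ R := fun R hR =>
    Complex.imCLM.hasFDerivAt.comp_hasDerivAt R (hasDerivAt_hankelIntegral hs hc hR hz)
  obtain ⟨c, hcm, h⟩ := exists_hasDerivAt_eq_slope _ _ hR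
    (fun x hx => (hd x hx.1).continuousAt.continuousWithinAt) (fun x hx => hd x hx.1.le)
  rw [integral_contour_deriv hs hc hcm.1, Complex.imCLM_apply, Complex.neg_im, Complex.ofReal_im,
    neg_zero, eq_comm, div_eq_zero_iff] at h
  rcases h with h | h <;> linarith

theorem continuous_hankelIntegral {φ R : ℝ} (hs : 0 < sin φ) (hc : cos φ < 0) (hR : 0 < R) :
    Continuous (hankelIntegral φ R) := by
  refine continuous_iff_continuousAt.2 fun z₀ => ?_
  refine continuousAt_of_dominated (bound := fun r =>
    rexp (obliqueRay φ R r).re * ‖obliqueRay φ R r‖ ^ z₀ +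
      rexp (obliqueRay φ R r).re * ‖obliqueRay φ R r‖ ^ (z₀ - 2)) ?_ ?_ ?_ ?_
  · exact Eventually.of_forall fun z => (measurable_contour_integrand φ R _).aestronglyMeasurable
  · filter_upwards [Metric.ball_mem_nhds z₀ one_pos] with z hz
    rw [Metric.mem_ball, Real.dist_eq, abs_lt] at hz
    filter_upwards [ae_restrict_mem measurableSet_Ioi] with r hr
    rw [norm_contour_integrand, ← mul_add]
    have hn : 0 < ‖obliqueRay φ R r‖ := lt_of_lt_of_le (by positivity) mul_sin_le_norm_obliqueRay
    gcongr
    rcases le_total 1 ‖obliqueRay φ R r‖ with h | h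
    · exact (rpow_le_rpow_of_exponent_le h (by linarith)).trans
        (le_add_of_nonneg_right (by positivity))
    · exact (rpow_le_rpow_of_exponent_ge hn h (by linarith)).trans
        (le_add_of_nonneg_left (by positivity))
  · exact (integrableOn_contour_rpow hs hc _ hR).add (integrableOn_contour_rpow hs hc _ hR)
  · filter_upwards [ae_restrict_mem measurableSet_Ioi] with r hr
    have h0 : obliqueRay φ R r ≠ 0 := Complex.slitPlane_ne_zero
      (obliqueRay_mem_slitPlane hs (le_of_lt hr) (Or.inl hR))
    have : Continuous fun z : ℝ => obliqueRay φ R r ^ ((z - 1 : ℝ) : ℂ) :=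
      Continuous.const_cpow (by fun_prop) (Or.inl h0)
    exact ((continuous_const.mul this).mul continuous_const).continuousAt

/-- Hankel's formula for the reciprocal Gamma function. -/
theorem hankelIntegral_im {φ R : ℝ} (hφ0 : 0 < φ) (hφ : φ < π) (hc : cos φ < 0) (hR : 0 < R)
    (z : ℝ) : (hankelIntegral φ R z).im = π * (Real.Gamma (1 - z))⁻¹ := by
  have hs : 0 < sin φ := sin_pos_of_pos_of_lt_pi hφ0 hφ
  have hirr : ∀ n : ℕ, ∀ z : ℝ, Irrational z → 2 - n < z →
      (hankelIntegral φ R z).im = π * (Real.Gamma (1 - z))⁻¹ := by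
    intro n
    induction n with
    | zero =>
      intro z hzi hz
      have hz : 2 < z := by simpa using hz
      have hsin : sin (π * z) ≠ 0 := by
        rw [Ne, sin_eq_zero_iff]
        rintro ⟨n, hn⟩
        rw [mul_comm] at hn
        exact hzi.ne_int n (mul_left_cancel₀ pi_ne_zero hn).symm
      rw [hankelIntegral_im_eq_zero_im hs hc hR hz, hankelIntegral_zero_im hφ0 hφ hc (by linarith)]
      have h := Real.Gamma_mul_Gamma_one_sub z
      have h1 : Real.Gamma (1 - z) ≠ 0 := by
        intro h1
        rw [h1, mul_zero, eq_comm, div_eq_zero_iff] at h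
        exact h.elim pi_ne_zero hsin
      rw [eq_div_iff hsin] at h
      field_simp
      linarith
    | succ n ih =>
      intro z hzi hz
      have hz0 : z ≠ 0 := hzi.ne_zero
      have h := ih (z + 1) (by exact_mod_cast hzi.add_natCast 1) (by push_cast at hz; linarith)
      rw [hankelIntegral_add_one_im hs hc hR] at h
      have hg := Real.Gamma_add_one (s := -z) (by simpa using hz0)
      rw [show 1 - (z + 1) = -z by ring] at h
      rw [show 1 - z = -z + 1 by ring, hg, mul_inv]
      have hz0' : -z ≠ 0 := by simpa using hz0
      rw [mul_left_comm, ← h]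
      field_simp
  have hcont : Continuous fun z : ℝ => π * (Real.Gamma (1 - z))⁻¹ := by
    have h1 := Complex.differentiable_one_div_Gamma.continuous
    have h2 : Continuous fun z : ℝ => (((Complex.Gamma ((1 - z : ℝ) : ℂ))⁻¹).re) :=
      Complex.continuous_re.comp (h1.comp (by fun_prop : Continuous fun z : ℝ => ((1 - z : ℝ) : ℂ)))
    have h3 : ∀ z : ℝ, (((Complex.Gamma ((1 - z : ℝ) : ℂ))⁻¹).re) = (Real.Gamma (1 - z))⁻¹ := by
      intro z
      rw [Complex.Gamma_ofReal, ← Complex.ofReal_inv, Complex.ofReal_re]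
    simp only [h3] at h2
    fun_prop
  refine congrFun (Continuous.ext_on dense_irrational
    (Complex.continuous_im.comp (continuous_hankelIntegral hs hc hR)) hcont fun z hz => ?_) z
  obtain ⟨n, hn⟩ := exists_nat_gt (2 - z)
  exact hirr n z hz (by linarith)

/-- The `M`-Wright function. -/
noncomputable def mWright (β x : ℝ) : ℝ :=
  ∑' k : ℕ, (-x) ^ k / ((Nat.factorial k : ℝ) * Real.Gamma (1 - β * (k + 1)))

theorem hasSum_contour_mWright {β φ R : ℝ} (hβ1 : β < 1) (hs : 0 < sin φ)
    (hc : cos φ < 0) (hR : 0 < R) (x : ℝ) :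
    HasSum (fun k : ℕ => (((-x) ^ k / (Nat.factorial k : ℝ) : ℝ) : ℂ) *
        hankelIntegral φ R (β * (k + 1)))
      (∫ r in Ioi (0:ℝ), Complex.exp (obliqueRay φ R r) * obliqueRay φ R r ^ ((β - 1 : ℝ) : ℂ) *
        Complex.exp (φ * Complex.I) * Complex.exp (-(x * obliqueRay φ R r ^ (β : ℂ)))) := by
  simp only [hankelIntegral, ← integral_const_mul]
  have hsum : ∀ r, HasSum (fun k : ℕ => |x| ^ k / (Nat.factorial k : ℝ) *
      (rexp (obliqueRay φ R r).re * (‖obliqueRay φ R r‖ ^ (β - 1) * (‖obliqueRay φ R r‖ ^ β) ^ k)))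
      (rexp (obliqueRay φ R r).re * (‖obliqueRay φ R r‖ ^ (β - 1) *
        rexp (|x| * ‖obliqueRay φ R r‖ ^ β))) := by
    intro r
    have h := NormedSpace.expSeries_div_hasSum_exp (|x| * ‖obliqueRay φ R r‖ ^ β)
    rw [← Real.exp_eq_exp_ℝ] at h
    have h2 := h.mul_left (rexp (obliqueRay φ R r).re * ‖obliqueRay φ R r‖ ^ (β - 1))
    rw [← mul_assoc]
    refine h2.congr_fun fun k => ?_
    rw [mul_pow]
    ring
  refine hasSum_integral_of_dominated_convergence (fun k r => |x| ^ k / (Nat.factorial k : ℝ) *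
      (rexp (obliqueRay φ R r).re * (‖obliqueRay φ R r‖ ^ (β - 1) * (‖obliqueRay φ R r‖ ^ β) ^ k)))
    ?_ ?_ ?_ ?_ ?_
  · intro k
    exact ((measurable_contour_integrand φ R _).const_mul _).aestronglyMeasurable
  · intro k
    filter_upwards [ae_restrict_mem measurableSet_Ioi] with r hr
    have hn : 0 < ‖obliqueRay φ R r‖ := lt_of_lt_of_le (by positivity) mul_sin_le_norm_obliqueRay
    rw [norm_mul, norm_contour_integrand, Complex.norm_real, norm_div, norm_pow, norm_neg,
      ← rpow_mul_natCast hn.le, ← rpow_add hn]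
    simp only [Real.norm_eq_abs, Nat.abs_cast]
    rw [show β - 1 + β * k = β * (k + 1) - 1 by ring]
  · exact Eventually.of_forall fun r => (hsum r).summable
  · simp only [fun r => (hsum r).tsum_eq]
    exact integrableOn_contour_majorant hβ1 hs hc _ hR
  · filter_upwards [ae_restrict_mem measurableSet_Ioi] with r hr
    have h0 : obliqueRay φ R r ≠ 0 := Complex.slitPlane_ne_zero
      (obliqueRay_mem_slitPlane hs (le_of_lt hr) (Or.inl hR))
    have h := NormedSpace.expSeries_div_hasSum_exp (-(x * obliqueRay φ R r ^ (β : ℂ)))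
    rw [← Complex.exp_eq_exp_ℂ] at h
    refine (h.mul_left (Complex.exp (obliqueRay φ R r) * obliqueRay φ R r ^ ((β - 1 : ℝ) : ℂ) *
      Complex.exp (φ * Complex.I))).congr_fun fun k => ?_
    have : obliqueRay φ R r ^ ((β * (k + 1) - 1 : ℝ) : ℂ) =
        obliqueRay φ R r ^ ((β - 1 : ℝ) : ℂ) * (obliqueRay φ R r ^ (β : ℂ)) ^ k := by
      rw [← Complex.cpow_mul_nat, ← Complex.cpow_add _ _ h0]
      congr 1
      push_cast
      ring
    rw [this, ← neg_mul, mul_pow]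
    push_cast
    ring

theorem mWright_eq_contour {β φ R : ℝ} (hβ1 : β < 1) (hφ0 : 0 < φ) (hφ : φ < π)
    (hc : cos φ < 0) (hR : 0 < R) (x : ℝ) :
    mWright β x = π⁻¹ * (∫ r in Ioi (0:ℝ), Complex.exp (obliqueRay φ R r) *
      obliqueRay φ R r ^ ((β - 1 : ℝ) : ℂ) * Complex.exp (φ * Complex.I) *
        Complex.exp (-(x * obliqueRay φ R r ^ (β : ℂ)))).im := by
  have hs : 0 < sin φ := sin_pos_of_pos_of_lt_pi hφ0 hφ
  have h := (Complex.hasSum_im (hasSum_contour_mWright hβ1 hs hc hR x)).mul_left π⁻¹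
  rw [← h.tsum_eq, mWright]
  congr 1 with k
  rw [Complex.im_ofReal_mul, hankelIntegral_im hφ0 hφ hc hR]
  have := pi_ne_zero
  rw [mul_left_comm, inv_mul_cancel_left₀ this, ← div_eq_mul_inv, div_div]

theorem integral_cexp_neg_mul_sin {p : ℂ} (hp : 0 < p.re) (l : ℝ) :
    ∫ x in Ioi (0:ℝ), Complex.exp (-(x * p)) * (Real.sin (l * x) : ℂ) = l / (p ^ 2 + l ^ 2) := by
  have h1 : (-p + l * Complex.I).re < 0 := by simpa using hp
  have h2 : (-p - l * Complex.I).re < 0 := by simpa using hp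
  have e1 : -p + l * Complex.I ≠ 0 := fun h => by simp [h] at h1
  have e2 : -p - l * Complex.I ≠ 0 := fun h => by simp [h] at h2
  have hfun : ∀ x : ℝ, Complex.exp (-(x * p)) * (Real.sin (l * x) : ℂ) =
      (Complex.exp ((-p - l * Complex.I) * x) - Complex.exp ((-p + l * Complex.I) * x)) *
        (Complex.I / 2) := by
    intro x
    rw [Complex.ofReal_sin, Complex.sin,
      show (-p - l * Complex.I) * x = -(x * p) + -((l * x : ℝ) : ℂ) * Complex.I by push_cast; ring,
      show (-p + l * Complex.I) * x = -(x * p) + ((l * x : ℝ) : ℂ) * Complex.I by push_cast; ring,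
      Complex.exp_add, Complex.exp_add]
    ring
  simp only [hfun]
  rw [integral_mul_const, integral_sub (integrableOn_exp_mul_complex_Ioi h2 0)
    (integrableOn_exp_mul_complex_Ioi h1 0), integral_exp_mul_complex_Ioi h1,
    integral_exp_mul_complex_Ioi h2]
  have e3 : p ^ 2 + l ^ 2 = (-p + l * Complex.I) * (-p - l * Complex.I) := by
    ring_nf; rw [Complex.I_sq]; ring
  rw [e3]
  simp only [Complex.ofReal_zero, mul_zero, Complex.exp_zero]
  field_simp
  ring_nf
  rw [Complex.I_sq]
  ring

theorem hasSum_contour_geometric {β φ R l : ℝ} (hs : 0 < sin φ)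
    (hc : cos φ < 0) (hR : 0 < R) (hl : 0 < l)
    (hlR : ∀ r, 2 * l ≤ ‖obliqueRay φ R r‖ ^ β) :
    HasSum (fun n : ℕ => (((-1) ^ n * l ^ (2 * n + 1) : ℝ) : ℂ) *
        hankelIntegral φ R (-((2 * n + 1) * β)))
      (∫ r in Ioi (0:ℝ), Complex.exp (obliqueRay φ R r) * obliqueRay φ R r ^ ((β - 1 : ℝ) : ℂ) *
        Complex.exp (φ * Complex.I) * (l / ((obliqueRay φ R r ^ (β : ℂ)) ^ 2 + l ^ 2))) := by
  simp only [hankelIntegral, ← integral_const_mul]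
  have hterm : ∀ n : ℕ, ∀ r, 0 < r → (((-1) ^ n * l ^ (2 * n + 1) : ℝ) : ℂ) *
      (Complex.exp (obliqueRay φ R r) * obliqueRay φ R r ^ ((-((2 * n + 1) * β) - 1 : ℝ) : ℂ) *
        Complex.exp (φ * Complex.I)) =
      Complex.exp (obliqueRay φ R r) * obliqueRay φ R r ^ ((β - 1 : ℝ) : ℂ) *
        Complex.exp (φ * Complex.I) * (l / (obliqueRay φ R r ^ (β : ℂ)) ^ 2 *
          (-(l / obliqueRay φ R r ^ (β : ℂ)) ^ 2) ^ n) := by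
    intro n r hr
    have h0 : obliqueRay φ R r ≠ 0 := Complex.slitPlane_ne_zero
      (obliqueRay_mem_slitPlane hs hr.le (Or.inl hR))
    have hp0 : obliqueRay φ R r ^ (β : ℂ) ≠ 0 := by simp [Complex.cpow_eq_zero_iff, h0]
    have : obliqueRay φ R r ^ ((-((2 * n + 1) * β) - 1 : ℝ) : ℂ) =
        obliqueRay φ R r ^ ((β - 1 : ℝ) : ℂ) *
          ((obliqueRay φ R r ^ (β : ℂ)) ^ (2 * n + 2))⁻¹ := by
      rw [← Complex.cpow_mul_nat, ← Complex.cpow_neg, ← Complex.cpow_add _ _ h0]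
      congr 1
      push_cast
      ring
    rw [this, neg_pow ((l / obliqueRay φ R r ^ (β : ℂ)) ^ 2), ← pow_mul, div_pow]
    push_cast
    field_simp
    ring
  have hratio : ∀ r, ‖-((l : ℂ) / obliqueRay φ R r ^ (β : ℂ)) ^ 2‖ ≤ 1 / 4 := by
    intro r
    have h := hlR r
    rw [norm_neg, norm_pow, norm_div, Complex.norm_cpow_real, Complex.norm_real,
      Real.norm_of_nonneg hl.le, show (1 / 4 : ℝ) = (1 / 2) ^ 2 by norm_num]
    refine pow_le_pow_left₀ (by positivity) ?_ 2
    rw [div_le_div_iff₀ (by linarith) (by norm_num)]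
    linarith
  refine hasSum_integral_of_dominated_convergence (fun n r =>
    rexp (obliqueRay φ R r).re * ‖obliqueRay φ R r‖ ^ (β - 1) * ((l / (2 * l) ^ 2) * (1 / 4) ^ n))
    ?_ ?_ ?_ ?_ ?_
  · intro k
    exact ((measurable_contour_integrand φ R _).const_mul _).aestronglyMeasurable
  · intro n
    filter_upwards [ae_restrict_mem measurableSet_Ioi] with r hr
    rw [hterm n r hr, norm_mul, norm_contour_integrand]
    gcongr
    rw [norm_mul, norm_pow, norm_div, norm_pow, Complex.norm_cpow_real, Complex.norm_real,
      Real.norm_of_nonneg hl.le]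
    have h := hlR r
    have h' := hratio r
    gcongr
  · exact Eventually.of_forall fun r =>
      ((summable_geometric_of_lt_one (by norm_num) (by norm_num)).mul_left _).mul_left _
  · simp only [tsum_mul_left]
    exact (integrableOn_contour_rpow hs hc _ hR).mul_const _
  · filter_upwards [ae_restrict_mem measurableSet_Ioi] with r hr
    have h0 : obliqueRay φ R r ≠ 0 := Complex.slitPlane_ne_zero
      (obliqueRay_mem_slitPlane hs (le_of_lt hr) (Or.inl hR))
    have hp0 : obliqueRay φ R r ^ (β : ℂ) ≠ 0 := by simp [Complex.cpow_eq_zero_iff, h0]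
    simp only [hterm _ r hr]
    refine HasSum.mul_left _ ?_
    have hq := (hratio r).trans_lt (by norm_num : (1 / 4 : ℝ) < 1)
    have hg := (hasSum_geometric_of_norm_lt_one hq).mul_left
      ((l : ℂ) / (obliqueRay φ R r ^ (β : ℂ)) ^ 2)
    convert hg using 1
    have hne : 1 - -((l : ℂ) / obliqueRay φ R r ^ (β : ℂ)) ^ 2 ≠ 0 := by
      intro h
      rw [← sub_eq_zero.1 h] at hq
      simp at hq
    rw [← div_eq_mul_inv, div_div]
    congr 1
    field_simp
    ring

/-- The sine transform of the `M`-Wright function. -/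
theorem integral_mWright_mul_sin {β l : ℝ} (hβ0 : 0 < β) (hβ1 : β < 1) (hl : 0 < l) :
    ∫ x in Ioi (0:ℝ), mWright β x * Real.sin (l * x) =
      ∑' n : ℕ, (-1) ^ n * l ^ (2 * n + 1) / Real.Gamma ((2 * n + 1) * β + 1) := by
  have hπ := pi_pos
  obtain ⟨φ, hφ2, hφ, hβφ⟩ : ∃ φ, π / 2 < φ ∧ φ < π ∧ β * φ < π / 2 := by
    refine ⟨π / (1 + β), ?_, ?_, ?_⟩
    · exact div_lt_div_of_pos_left hπ (by linarith) (by linarith)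
    · exact div_lt_self hπ (by linarith)
    · rw [mul_div_assoc', div_lt_div_iff₀ (by linarith) (by norm_num)]
      nlinarith
  have hφ0 : 0 < φ := by linarith
  have hs : 0 < sin φ := sin_pos_of_pos_of_lt_pi hφ0 hφ
  have hc : cos φ < 0 := cos_neg_of_pi_div_two_lt_of_lt hφ2 (by linarith)
  have hc' : 0 < cos (β * φ) := cos_pos_of_mem_Ioo ⟨by nlinarith, hβφ⟩
  obtain ⟨R, hR, hlR⟩ : ∃ R, 0 < R ∧ ∀ r, 2 * l ≤ ‖obliqueRay φ R r‖ ^ β := by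
    refine ⟨(2 * l) ^ β⁻¹ / sin φ, by positivity, fun r => ?_⟩
    have h := mul_sin_le_norm_obliqueRay (φ := φ) (R := (2 * l) ^ β⁻¹ / sin φ) (r := r)
    rw [div_mul_cancel₀ _ hs.ne'] at h
    calc 2 * l = ((2 * l) ^ β⁻¹) ^ β := (rpow_inv_rpow (by positivity) hβ0.ne').symm
      _ ≤ _ := by gcongr
  have hre : ∀ r, 0 < r → cos (β * φ) * (2 * l) ≤ (obliqueRay φ R r ^ (β : ℂ)).re := fun r hr =>
    (mul_le_mul_of_nonneg_left (hlR r) hc'.le).trans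
      (cos_mul_rpow_le_re_cpow hφ0 hφ hβ0 hβφ hR hr.le)
  have hint : Integrable (Function.uncurry fun (x r : ℝ) =>
      Complex.exp (obliqueRay φ R r) * obliqueRay φ R r ^ ((β - 1 : ℝ) : ℂ) *
        Complex.exp (φ * Complex.I) * (Complex.exp (-(x * obliqueRay φ R r ^ (β : ℂ))) *
          (Real.sin (l * x) : ℂ)))
      ((volume.restrict (Ioi (0:ℝ))).prod (volume.restrict (Ioi (0:ℝ)))) := by
    have hb := (integrableOn_exp_mul_Ioi (a := -(cos (β * φ) * (2 * l)))
      (by simp only [Left.neg_neg_iff]; positivity) 0).mul_prod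
      (integrableOn_contour_rpow hs hc (β - 1) hR)
    refine hb.mono' ?_ ?_
    · have := (continuous_obliqueRay φ R).measurable
      refine Measurable.aestronglyMeasurable ?_
      unfold Function.uncurry
      fun_prop
    · rw [Measure.prod_restrict]
      filter_upwards [ae_restrict_mem (measurableSet_Ioi.prod measurableSet_Ioi)] with ⟨x, r⟩ hxr
      have hx : 0 < x := hxr.1
      have hr : 0 < r := hxr.2
      simp only [Function.uncurry]
      rw [norm_mul, norm_contour_integrand, mul_comm]
      refine mul_le_mul_of_nonneg_right ?_ (by positivity)
      rw [norm_mul, Complex.norm_exp, Complex.norm_real, Real.norm_eq_abs]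
      refine (mul_le_of_le_one_right (exp_pos _).le (abs_sin_le_one _)).trans ?_
      rw [exp_le_exp, Complex.neg_re, Complex.re_ofReal_mul]
      have := mul_le_mul_of_nonneg_left (hre r hr) hx.le
      linarith
  have hswap := integral_integral_swap hint
  have hsum := hasSum_contour_geometric (β := β) hs hc hR hl hlR
  have hinner : ∀ r ∈ Ioi (0:ℝ), ∫ x in Ioi (0:ℝ),
      Complex.exp (obliqueRay φ R r) * obliqueRay φ R r ^ ((β - 1 : ℝ) : ℂ) *
        Complex.exp (φ * Complex.I) * (Complex.exp (-(x * obliqueRay φ R r ^ (β : ℂ))) *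
          (Real.sin (l * x) : ℂ)) =
      Complex.exp (obliqueRay φ R r) * obliqueRay φ R r ^ ((β - 1 : ℝ) : ℂ) *
        Complex.exp (φ * Complex.I) * (l / ((obliqueRay φ R r ^ (β : ℂ)) ^ 2 + l ^ 2)) := by
    intro r hr
    rw [integral_const_mul, integral_cexp_neg_mul_sin (lt_of_lt_of_le (by positivity) (hre r hr))]
  rw [setIntegral_congr_fun measurableSet_Ioi hinner] at hswap
  rw [← hswap] at hsum
  have hint' := hint.integral_prod_left
  have him := (Complex.hasSum_im hsum).mul_left π⁻¹
  calc ∫ x in Ioi (0:ℝ), mWright β x * Real.sin (l * x)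
      = ∫ x in Ioi (0:ℝ), π⁻¹ * (∫ r in Ioi (0:ℝ),
        Complex.exp (obliqueRay φ R r) * obliqueRay φ R r ^ ((β - 1 : ℝ) : ℂ) *
        Complex.exp (φ * Complex.I) * (Complex.exp (-(x * obliqueRay φ R r ^ (β : ℂ))) *
          (Real.sin (l * x) : ℂ))).im := by
        congr 1 with x
        rw [mWright_eq_contour hβ1 hφ0 hφ hc hR]
        simp only [← mul_assoc]
        rw [integral_mul_const, Complex.im_mul_ofReal, mul_assoc]
    _ = _ := by
        rw [integral_const_mul]
        have := integral_im (𝕜 := ℂ) hint'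
        simp only [Function.uncurry, RCLike.im_to_complex] at this
        rw [this, ← him.tsum_eq]
        congr 1 with n
        rw [Complex.im_ofReal_mul, hankelIntegral_im hφ0 hφ hc hR]
        rw [mul_left_comm, inv_mul_cancel_left₀ hπ.ne', ← div_eq_mul_inv, sub_neg_eq_add, add_comm 1]

theorem rpow_mul_exp_neg_le_Gamma {B y : ℝ} (hB : 0 < B) (hy : 0 ≤ y) :
    B ^ y * rexp (-B) ≤ Real.Gamma (y + 1) := by
  have hint : IntegrableOn (fun x => rexp (-x) * x ^ y) (Ioi 0) := by
    simpa using Real.GammaIntegral_convergent (s := y + 1) (by linarith)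
  have h0 : ∀ x ∈ Ioi (0:ℝ), 0 ≤ rexp (-x) * x ^ y := fun x hx =>
    mul_nonneg (exp_pos _).le (rpow_nonneg (le_of_lt hx) _)
  rw [Real.Gamma_eq_integral (by linarith), add_sub_cancel_right]
  calc B ^ y * rexp (-B) = ∫ x in Ioi B, rexp (-x) * B ^ y := by
        rw [integral_mul_const, integral_exp_neg_Ioi, mul_comm]
    _ ≤ ∫ x in Ioi B, rexp (-x) * x ^ y := by
        refine setIntegral_mono_on ((integrableOn_exp_neg_Ioi B).mul_const _)
          (hint.mono_set (Ioi_subset_Ioi hB.le)) measurableSet_Ioi fun x hx => ?_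
        have : B ≤ x := le_of_lt hx
        gcongr
    _ ≤ _ := setIntegral_mono_set hint (ae_restrict_of_forall_mem measurableSet_Ioi h0)
        (Ioi_subset_Ioi hB.le).eventuallyLE

theorem summable_pow_div_Gamma {β : ℝ} (hβ : 0 < β) (A : ℝ) :
    Summable fun n : ℕ => A ^ n / Real.Gamma (n * β + 1) := by
  set a := |A| + 1 with ha
  have ha0 : 0 < a := by positivity
  have hB : 0 < (2 * a) ^ β⁻¹ := by positivity
  refine Summable.of_norm_bounded (g := fun n : ℕ => rexp ((2 * a) ^ β⁻¹) * (1 / 2) ^ n)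
    ((summable_geometric_of_lt_one (by norm_num) (by norm_num)).mul_left _) fun n => ?_
  have hG := rpow_mul_exp_neg_le_Gamma hB (by positivity : 0 ≤ (n : ℝ) * β)
  rw [mul_comm (n : ℝ), rpow_mul hB.le, rpow_inv_rpow (by positivity) hβ.ne', rpow_natCast] at hG
  have hG0 : 0 < Real.Gamma (β * n + 1) := Real.Gamma_pos_of_pos (by positivity)
  rw [norm_div, norm_pow, Real.norm_eq_abs, mul_comm (n : ℝ), Real.norm_of_nonneg hG0.le,
    div_le_iff₀ hG0]
  calc |A| ^ n ≤ a ^ n := by gcongr; linarith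
    _ = rexp ((2 * a) ^ β⁻¹) * (1 / 2) ^ n * ((2 * a) ^ n * rexp (-(2 * a) ^ β⁻¹)) := by
        rw [exp_neg, mul_pow, one_div, inv_pow]
        field_simp
    _ ≤ _ := by gcongr

theorem integral_sub_rpow_mul_rpow {u v t : ℝ} (hu : 0 < u) (hv : 0 < v) (ht : 0 < t) :
    IntegrableOn (fun τ => (t - τ) ^ (v - 1) * τ ^ (u - 1)) (Ioc 0 t) ∧
    ∫ τ in Ioc 0 t, (t - τ) ^ (v - 1) * τ ^ (u - 1) =
      Real.Gamma u * Real.Gamma v / Real.Gamma (u + v) * t ^ (u + v - 1) := by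
  have hG : Real.Gamma (u + v) ≠ 0 := (Real.Gamma_pos_of_pos (by linarith)).ne'
  have hval : ∫ τ in Ioc 0 t, (t - τ) ^ (v - 1) * τ ^ (u - 1) =
      Real.Gamma u * Real.Gamma v / Real.Gamma (u + v) * t ^ (u + v - 1) := by
    have h := Complex.betaIntegral_scaled u v ht
    have hb := Complex.Gamma_mul_Gamma_eq_betaIntegral (s := u) (t := v) (by simpa) (by simpa)
    rw [← Complex.ofReal_add, Complex.Gamma_ofReal, Complex.Gamma_ofReal, Complex.Gamma_ofReal]
      at hb
    have hG' : (Real.Gamma (u + v) : ℂ) ≠ 0 := by exact_mod_cast hG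
    rw [show Complex.betaIntegral u v =
      ((Real.Gamma u * Real.Gamma v / Real.Gamma (u + v) : ℝ) : ℂ) by
        push_cast; rw [hb]; field_simp, intervalIntegral.integral_of_le ht.le] at h
    apply Complex.ofReal_injective
    rw [← integral_complex_ofReal, Complex.ofReal_mul, Complex.ofReal_cpow ht.le, mul_comm]
    push_cast at h ⊢
    rw [← h]
    refine setIntegral_congr_fun measurableSet_Ioc fun τ hτ => ?_
    have h1 : 0 ≤ t - τ := sub_nonneg.2 hτ.2
    rw [Complex.ofReal_cpow h1, Complex.ofReal_cpow hτ.1.le]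
    push_cast
    ring
  refine ⟨?_, hval⟩
  by_contra hn
  rw [integral_undef hn] at hval
  have := Real.Gamma_pos_of_pos hu
  have := Real.Gamma_pos_of_pos hv
  have : 0 < t ^ (u + v - 1) := by positivity
  exact absurd hval.symm (by positivity)

theorem hasDerivAt_tsum_rpow_div_Gamma {β K A : ℝ} (hβ : 0 < β) (hA : 0 < A) {c : ℕ → ℝ}
    (hc : ∀ n, |c n| ≤ K * A ^ n) {t : ℝ} (ht : 0 < t) :
    HasDerivAt (fun τ => ∑' n : ℕ, c n * τ ^ (n * β) / Real.Gamma (n * β + 1))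
      (∑' n : ℕ, c (n + 1) * t ^ ((n + 1) * β - 1) / Real.Gamma ((n + 1) * β)) t := by
  have hK : 0 ≤ K := by simpa using (abs_nonneg _).trans (hc 0)
  have hG0 : ∀ n : ℕ, 0 < Real.Gamma (n * β + 1) := fun n => Real.Gamma_pos_of_pos (by positivity)
  have hu : Summable fun n : ℕ =>
      K * (β * (2 / t)) * ((2 * A * (2 * t) ^ β) ^ n / Real.Gamma (n * β + 1)) :=
    (summable_pow_div_Gamma hβ _).mul_left _
  have hmem : t ∈ Ioo (t / 2) (2 * t) := ⟨by linarith, by linarith⟩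
  have hbound : ∀ (n : ℕ) τ, τ ∈ Ioo (t / 2) (2 * t) →
      ‖c n * (n * β * τ ^ (n * β - 1)) / Real.Gamma (n * β + 1)‖ ≤
      K * (β * (2 / t)) * ((2 * A * (2 * t) ^ β) ^ n / Real.Gamma (n * β + 1)) := by
    intro n τ hτ
    have hτ0 : 0 < τ := by linarith [hτ.1]
    rw [norm_div, norm_mul, Real.norm_of_nonneg (hG0 n).le, Real.norm_eq_abs,
      Real.norm_of_nonneg (by positivity), ← mul_div_assoc]
    have h1 : τ ^ (n * β - 1) ≤ ((2 * t) ^ β) ^ n * (2 / t) := by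
      rw [rpow_sub_one hτ0.ne', div_eq_mul_inv, mul_comm (n : ℝ), rpow_mul hτ0.le, rpow_natCast]
      have h2 : τ⁻¹ ≤ 2 / t := by
        rw [← inv_div]
        exact inv_anti₀ (by positivity) hτ.1.le
      have h3 := hτ.2.le
      gcongr
    have h2 : (n : ℝ) ≤ 2 ^ n := by exact_mod_cast Nat.lt_two_pow_self.le
    refine div_le_div_of_nonneg_right ?_ (hG0 n).le
    calc |c n| * (n * β * τ ^ (n * β - 1))
        ≤ K * A ^ n * (2 ^ n * β * (((2 * t) ^ β) ^ n * (2 / t))) := by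
          gcongr
          exact hc n
      _ = _ := by rw [mul_pow, mul_pow]; ring
  have hg0 : Summable fun n : ℕ => c n * t ^ (n * β) / Real.Gamma (n * β + 1) := by
    refine Summable.of_norm_bounded ((summable_pow_div_Gamma hβ (A * t ^ β)).mul_left K) fun n => ?_
    rw [norm_div, norm_mul, Real.norm_of_nonneg (hG0 n).le, Real.norm_eq_abs,
      Real.norm_of_nonneg (by positivity), ← mul_div_assoc, mul_pow, mul_comm (n : ℝ),
      rpow_mul ht.le, rpow_natCast, ← mul_assoc, mul_comm β]
    have := hc n
    have := hG0 n
    gcongr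
  have h := hasDerivAt_tsum_of_isPreconnected hu isOpen_Ioo isPreconnected_Ioo
    (g := fun (n : ℕ) τ => c n * τ ^ (n * β) / Real.Gamma (n * β + 1))
    (g' := fun (n : ℕ) τ => c n * (n * β * τ ^ (n * β - 1)) / Real.Gamma (n * β + 1))
    (fun n τ hτ => ((Real.hasDerivAt_rpow_const (Or.inl (by linarith [hτ.1]))).const_mul
      _).div_const _) hbound hmem hg0 hmem
  refine h.congr_deriv ?_
  have hs : Summable fun n : ℕ => c n * (n * β * t ^ (n * β - 1)) / Real.Gamma (n * β + 1) :=
    Summable.of_norm_bounded hu fun n => hbound n t hmem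
  rw [hs.tsum_eq_zero_add]
  simp only [Nat.cast_zero, zero_mul, mul_zero, zero_div, zero_add]
  congr 1 with n
  have hn : ((n + 1 : ℕ) : ℝ) * β ≠ 0 := by positivity
  rw [Real.Gamma_add_one hn]
  push_cast at hn ⊢
  field_simp

/-- The Caputo derivative acts on series in `t ^ β / Γ` as a shift of the coefficients. -/
theorem caputo_tsum_rpow_div_Gamma {β K A : ℝ} (hβ0 : 0 < β) (hβ1 : β < 1) (hA : 0 < A)
    {c : ℕ → ℝ} (hc : ∀ n, |c n| ≤ K * A ^ n) {f : ℝ → ℝ}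
    (hf : ∀ t, 0 < t → f t = ∑' n : ℕ, c n * t ^ (n * β) / Real.Gamma (n * β + 1))
    {t : ℝ} (ht : 0 < t) :
    caputo β f t = ∑' n : ℕ, c (n + 1) * t ^ (n * β) / Real.Gamma (n * β + 1) := by
  have hG1 : 0 < Real.Gamma (1 - β) := Real.Gamma_pos_of_pos (by linarith)
  have hG0 : ∀ n : ℕ, 0 < Real.Gamma (n * β + 1) := fun n => Real.Gamma_pos_of_pos (by positivity)
  have hG2 : ∀ n : ℕ, 0 < Real.Gamma ((n + 1) * β) := fun n =>
    Real.Gamma_pos_of_pos (by positivity)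
  have hint : ∀ n : ℕ, IntegrableOn (fun τ => (t - τ) ^ (-β) * τ ^ ((n + 1) * β - 1)) (Ioc 0 t) ∧
      ∫ τ in Ioc 0 t, (t - τ) ^ (-β) * τ ^ ((n + 1) * β - 1) =
        Real.Gamma ((n + 1) * β) * Real.Gamma (1 - β) / Real.Gamma (n * β + 1) * t ^ (n * β) := by
    intro n
    have h := integral_sub_rpow_mul_rpow (u := (n + 1) * β) (v := 1 - β) (by positivity)
      (by linarith) ht
    rwa [show 1 - β - 1 = -β by ring, show (n + 1) * β + (1 - β) = n * β + 1 by ring,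
      add_sub_cancel_right] at h
  have hderiv : ∀ τ ∈ Ioc 0 t, (t - τ) ^ (-β) * deriv f τ =
      ∑' n : ℕ, c (n + 1) / Real.Gamma ((n + 1) * β) *
        ((t - τ) ^ (-β) * τ ^ ((n + 1) * β - 1)) := by
    intro τ hτ
    have h := (hasDerivAt_tsum_rpow_div_Gamma hβ0 hA hc hτ.1).congr_of_eventuallyEq
      (f₁ := f) ((eventually_gt_nhds hτ.1).mono fun s hs => hf s hs)
    rw [h.deriv, ← tsum_mul_left]
    congr 1 with n
    ring
  have hsum := hasSum_integral_of_summable_integral_norm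
    (F := fun (n : ℕ) τ => c (n + 1) / Real.Gamma ((n + 1) * β) *
      ((t - τ) ^ (-β) * τ ^ ((n + 1) * β - 1))) (μ := volume.restrict (Ioc 0 t))
    (fun n => (hint n).1.const_mul _) (by
      have hK : ∀ n : ℕ, ∫ τ in Ioc 0 t, ‖c (n + 1) / Real.Gamma ((n + 1) * β) *
          ((t - τ) ^ (-β) * τ ^ ((n + 1) * β - 1))‖ =
          Real.Gamma (1 - β) * (|c (n + 1)| * t ^ (n * β) / Real.Gamma (n * β + 1)) := by
        intro n
        have h1 : ∀ τ ∈ Ioc 0 t, ‖c (n + 1) / Real.Gamma ((n + 1) * β) *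
          ((t - τ) ^ (-β) * τ ^ ((n + 1) * β - 1))‖ = |c (n + 1)| / Real.Gamma ((n + 1) * β) *
          ((t - τ) ^ (-β) * τ ^ ((n + 1) * β - 1)) := by
          intro τ hτ
          have h1 : 0 ≤ t - τ := sub_nonneg.2 hτ.2
          have h2 := hτ.1.le
          rw [norm_mul, norm_div, Real.norm_of_nonneg (hG2 n).le, Real.norm_eq_abs,
            Real.norm_of_nonneg (by positivity)]
        rw [setIntegral_congr_fun measurableSet_Ioc h1, integral_const_mul, (hint n).2]
        have := (hG2 n).ne'
        field_simp
      simp only [hK]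
      refine Summable.mul_left _ ?_
      refine Summable.of_norm_bounded ((summable_pow_div_Gamma hβ0 (A * t ^ β)).mul_left (K * A))
        fun n => ?_
      rw [norm_div, norm_mul, Real.norm_of_nonneg (hG0 n).le, Real.norm_eq_abs, abs_abs,
        Real.norm_of_nonneg (by positivity), ← mul_div_assoc, mul_pow, mul_comm (n : ℝ),
        rpow_mul ht.le, rpow_natCast, ← mul_assoc, mul_comm β, mul_assoc K, ← pow_succ']
      have := hc (n + 1)
      have := hG0 n
      gcongr)
  rw [caputo, intervalIntegral.integral_of_le ht.le,
    setIntegral_congr_fun measurableSet_Ioc hderiv, ← hsum.tsum_eq, ← tsum_mul_left]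
  congr 1 with n
  rw [integral_const_mul, (hint n).2]
  have := (hG2 n).ne'
  field_simp

/-- The Wright-type transform of the sine function. -/
theorem integral_wrightG_mul_sin {β ω t : ℝ} (hβ0 : 0 < β) (hβ1 : β < 1) (hω : 0 < ω)
    (ht : 0 < t) :
    ∫ x in Ioi (0:ℝ), wrightG β x t * Real.sin (ω * x) =
      ∑' n : ℕ, (-1 : ℝ) ^ n * ω ^ (2 * n + 1) * t ^ ((2 * (n : ℝ) + 1) * β) /
        Real.Gamma ((2 * (n : ℝ) + 1) * β + 1) := by
  have hb : 0 < t ^ (-β) := by positivity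
  have hl : 0 < ω * t ^ β := by positivity
  have hbt : t ^ β * t ^ (-β) = 1 := by rw [← rpow_add ht, add_neg_cancel, rpow_zero]
  have h := integral_comp_mul_left_Ioi
    (fun x => mWright β x * Real.sin (ω * t ^ β * x)) 0 hb
  rw [mul_zero, integral_mWright_mul_sin hβ0 hβ1 hl, smul_eq_mul] at h
  have hfun : ∀ x, wrightG β x t * Real.sin (ω * x) = t ^ (-β) *
      (mWright β (t ^ (-β) * x) * Real.sin (ω * t ^ β * (t ^ (-β) * x))) := by
    intro x
    rw [wrightG, mWright, show -x / t ^ β = -(t ^ (-β) * x) by rw [rpow_neg ht.le]; ring,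
      show ω * t ^ β * (t ^ (-β) * x) = ω * (t ^ β * t ^ (-β)) * x by ring, hbt]
    ring_nf
  simp only [hfun]
  rw [integral_const_mul, h, mul_inv_cancel_left₀ hb.ne']
  congr 1 with n
  rw [mul_pow, ← rpow_mul_natCast ht.le]
  push_cast
  ring_nf

theorem tsum_sin_coeff_eq {β ω t : ℝ} :
    ∑' n : ℕ, ω ^ n * Real.sin (n * (π / 2)) * t ^ (n * β) / Real.Gamma (n * β + 1) =
      ∑' n : ℕ, (-1 : ℝ) ^ n * ω ^ (2 * n + 1) * t ^ ((2 * (n : ℝ) + 1) * β) /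
        Real.Gamma ((2 * (n : ℝ) + 1) * β + 1) := by
  have hinj : Function.Injective fun n : ℕ => 2 * n + 1 := fun a b h => by simpa using h
  rw [← hinj.tsum_eq]
  · congr 1 with n
    push_cast
    rw [show (2 * (n : ℝ) + 1) * (π / 2) = n * π + π / 2 by ring, Real.sin_add_pi_div_two,
      Real.cos_nat_mul_pi]
    ring
  · intro n hn
    rcases Nat.even_or_odd' n with ⟨k, rfl | rfl⟩
    · refine absurd ?_ hn
      beta_reduce
      rw [Nat.cast_mul, show ((2 : ℕ) : ℝ) * k * (π / 2) = k * π by push_cast; ring,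
        Real.sin_nat_mul_pi]
      simp
    · exact ⟨k, rfl⟩

theorem caputo_caputo_add_sq_mul {β ω : ℝ} (hβ0 : 0 < β) (hβ1 : β < 1) (hω : 0 < ω)
    {V : ℝ → ℝ} (hV : ∀ t, 0 < t →
      V t = ∑' n : ℕ, ω ^ n * Real.sin (n * (π / 2)) * t ^ (n * β) / Real.Gamma (n * β + 1))
    {t : ℝ} (ht : 0 < t) : caputo β (caputo β V) t + ω ^ 2 * V t = 0 := by
  have hc : ∀ n : ℕ, |ω ^ n * Real.sin (n * (π / 2))| ≤ 1 * ω ^ n := fun n => by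
    rw [abs_mul, abs_of_pos (by positivity), one_mul]
    exact mul_le_of_le_one_right (by positivity) (abs_sin_le_one _)
  have h1 : ∀ t, 0 < t → caputo β V t = _ := fun t ht =>
    caputo_tsum_rpow_div_Gamma hβ0 hβ1 hω hc hV ht
  rw [caputo_tsum_rpow_div_Gamma (K := ω) hβ0 hβ1 hω
    (fun n => (hc (n + 1)).trans_eq (by ring)) h1 ht, hV t ht, ← tsum_mul_left,
    add_eq_zero_iff_eq_neg, ← tsum_neg]
  congr 1 with n
  push_cast
  rw [show ((n : ℝ) + 1 + 1) * (π / 2) = n * (π / 2) + π by ring, Real.sin_add_pi]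
  ring

/-- Fractional LC circuit. For `ω > 0`, the function
`V(t) = ω t^β E_{2β,β+1}(−ω² t^{2β}) = ∑ (−1)ⁿ ω^{2n+1} t^{(2n+1)β}/Γ((2n+1)β+1)`
satisfies `(D_c^β)² V + ω² V = 0` on `(0,∞)` with `V(0) = 0`, and equals the Wright-type
transform of `s ↦ sin(ωs)`. -/
theorem fractional_LC_circuit (β ω : ℝ) (hβ0 : 0 < β) (hβ1 : β < 1) (hω : 0 < ω)
    (V : ℝ → ℝ)
    (hV : ∀ t : ℝ, V t = ω * t ^ β * mittagLeffler (2 * β) (β + 1) (-(ω ^ 2) * t ^ (2 * β))) :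
    (∀ t : ℝ, 0 < t → V t = ∑' n : ℕ, (-1 : ℝ) ^ n * ω ^ (2 * n + 1)
        * t ^ ((2 * (n : ℝ) + 1) * β) / Real.Gamma ((2 * (n : ℝ) + 1) * β + 1)) ∧
    (∀ t : ℝ, 0 < t → (caputo β)^[2] V t + ω ^ 2 * V t = 0) ∧
    V 0 = 0 ∧
    (∀ t : ℝ, 0 < t → V t = ∫ x in Set.Ioi (0:ℝ), wrightG β x t * Real.sin (ω * x)) := by
  have hseries : ∀ t : ℝ, 0 < t → V t = ∑' n : ℕ, (-1 : ℝ) ^ n * ω ^ (2 * n + 1)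
      * t ^ ((2 * (n : ℝ) + 1) * β) / Real.Gamma ((2 * (n : ℝ) + 1) * β + 1) := by
    intro t ht
    rw [hV, mittagLeffler, ← tsum_mul_left]
    congr 1 with n
    rw [show (2 * (n : ℝ) + 1) * β = 2 * β * n + β by ring, rpow_add ht, rpow_mul_natCast ht.le,
      neg_mul, neg_pow, mul_pow, ← pow_mul, ← add_assoc]
    ring
  refine ⟨hseries, fun t ht => ?_, ?_, fun t ht => ?_⟩
  · exact caputo_caputo_add_sq_mul hβ0 hβ1 hω
      (fun t ht => (hseries t ht).trans tsum_sin_coeff_eq.symm) ht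
  · rw [hV, zero_rpow hβ0.ne', mul_zero, zero_mul]
  · rw [hseries t ht, integral_wrightG_mul_sin hβ0 hβ1 hω ht]
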